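/- Let G ⊆ ℝⁿ × ℝ be a compact set and F : ℝⁿ × ℝ → Set ℝⁿ a set-valued map that is upper semicontinuous on G and such that for every (x,t) ∈ G the set F(x,t) is nonempty, compact and convex. Then every solution x of ẋ ∈ F(x,t) on an interval [t₀,t₁] whose graph {(x(t),t) : t ∈ [t₀,t₁]} lies in G can be extended to a solution x̃ on some interval [t₀,T] with T ≥ t₁ whose graph lies in G and such that (x̃(T),T) belongs to the boundary of G. -/

import Mathlib

open MeasureTheory Set Filter

noncomputable section

/-- `ℝⁿ` as a Euclidean space. -/
abbrev En (n : ℕ) := EuclideanSpace ℝ (Fin n)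

/-- `x` is a solution of the differential inclusion `ẋ ∈ F (x, t)` on the time interval `I`
(containing `t₀`): there is a locally integrable `v` with
`x t = x t₀ + ∫_{t₀}^t v` on `I` and `v t ∈ F (x t) t` for a.e. `t ∈ I`. -/
def IsDISolution {n : ℕ} (F : En n → ℝ → Set (En n)) (I : Set ℝ) (t₀ : ℝ)
    (x : ℝ → En n) : Prop :=
  ∃ v : ℝ → En n, LocallyIntegrable v volume ∧
    (∀ t ∈ I, x t = x t₀ + ∫ s in t₀..t, v s) ∧
    (∀ᵐ t ∂(volume.restrict I), v t ∈ F (x t) t)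

/-- `F` is upper semicontinuous on `G`: at every point `p ∈ G`, the one-sided Hausdorff
excess `β(F q, F p) = sup_{w ∈ F q} dist (w, F p)` tends to `0` as `q → p`. -/
def USCOn {n : ℕ} (F : En n → ℝ → Set (En n)) (G : Set (En n × ℝ)) : Prop :=
  ∀ p ∈ G, ∀ ε > 0, ∃ δ > 0, ∀ q : En n × ℝ, dist q p < δ →
    ∀ w ∈ F q.1 q.2, Metric.infDist w (F p.1 p.2) < ε

open scoped NNReal Topology

lemma euler_step {n : ℕ} (Φ : En n × ℝ → Set (En n)) (M : ℝ≥0)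
    (hne : ∀ p, (Φ p).Nonempty) (hM : ∀ p, ∀ w ∈ Φ p, ‖w‖ ≤ M)
    (a : ℝ) (y₀ : En n) (h : ℝ) (hh : 0 < h) :
    ∃ z u : ℝ → En n, LipschitzWith M z ∧ z a = y₀ ∧
      (∀ s t, IntervalIntegrable u volume s t) ∧
      (∀ s t, z t - z s = ∫ r in s..t, u r) ∧
      (∀ s ≥ a, ∃ τ, s - h ≤ τ ∧ τ ≤ s ∧ u s ∈ Φ (z τ, τ)) := by
  choose σ hσ using hne
  let Y : ℕ → En n := fun j => Nat.rec y₀ (fun j y => y + h • σ (y, a + j * h)) j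
  have hY0 : Y 0 = y₀ := rfl
  have hYs : ∀ j, Y (j+1) = Y j + h • σ (Y j, a + j * h) := fun j => rfl
  let w : ℕ → En n := fun j => σ (Y j, a + j * h)
  let u : ℝ → En n := fun s => w ⌊(s - a) / h⌋₊
  have hum : Measurable u :=
    (measurable_from_nat (f := w)).comp (Nat.measurable_floor.comp (by fun_prop))
  have hub : ∀ s, ‖u s‖ ≤ M := fun s => hM _ _ (hσ _)
  have hui : ∀ s t, IntervalIntegrable u volume s t := by
    intro s t
    refine (intervalIntegrable_const (c := (M:ℝ))).mono_fun hum.aestronglyMeasurable ?_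
    exact Eventually.of_forall fun r => by simpa using hub r
  let z : ℝ → En n := fun t => y₀ + ∫ r in a..t, u r
  have hz : ∀ s t, z t - z s = ∫ r in s..t, u r := by
    intro s t
    simp only [z, add_sub_add_left_eq_sub]
    exact intervalIntegral.integral_interval_sub_left (hui _ _) (hui _ _)
  have hza : z a = y₀ := by simp [z]
  have hfloor : ∀ j : ℕ, ∀ s, a + j * h ≤ s → s < a + (j+1) * h → ⌊(s - a) / h⌋₊ = j := by
    intro j s h1 h2
    rw [Nat.floor_eq_iff (by apply div_nonneg _ hh.le; nlinarith [Nat.cast_nonneg (α := ℝ) j])]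
    constructor
    · rw [le_div_iff₀ hh]; linarith
    · rw [div_lt_iff₀ hh]; linarith
  have hzY : ∀ j : ℕ, z (a + j * h) = Y j := by
    intro j
    induction j with
    | zero => simp [hza, hY0]
    | succ j ih =>
      have h1 := hz (a + j * h) (a + (j+1) * h)
      have h2 : ∫ r in (a + j * h)..(a + (j+1) * h), u r
          = ∫ r in (a + j * h)..(a + (j+1) * h), w j := by
        apply intervalIntegral.integral_congr_ae
        have : ∀ᵐ r : ℝ, r ≠ a + (j+1) * h := by
          simp [ae_iff]
        filter_upwards [this] with r hr hr2
        rw [uIoc_of_le (by nlinarith)] at hr2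
        simp only [u]
        rw [hfloor j r hr2.1.le (lt_of_le_of_ne hr2.2 hr)]
      rw [h2, intervalIntegral.integral_const, ih] at h1
      have h3 : a + (j+1) * h - (a + j * h) = h := by ring
      rw [h3] at h1
      rw [hYs, Nat.cast_succ, ← sub_eq_iff_eq_add', h1]
  refine ⟨z, u, ?_, hza, hui, hz, ?_⟩
  · refine LipschitzWith.of_dist_le_mul fun s t => ?_
    rw [dist_eq_norm, hz, Real.dist_eq]
    exact intervalIntegral.norm_integral_le_of_norm_le_const fun r _ => hub r
  · intro s hs
    have h0 : 0 ≤ (s - a) / h := div_nonneg (by linarith) hh.le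
    refine ⟨a + ⌊(s - a) / h⌋₊ * h, ?_, ?_, ?_⟩
    · have := Nat.lt_floor_add_one ((s - a) / h)
      rw [div_lt_iff₀ hh] at this; linarith
    · have := Nat.floor_le h0
      rw [le_div_iff₀ hh] at this; linarith
    · rw [hzY]; exact hσ _

lemma exists_global {n : ℕ} (Φ : En n × ℝ → Set (En n)) (M : ℝ≥0)
    (hne : ∀ p, (Φ p).Nonempty) (hM : ∀ p, ∀ w ∈ Φ p, ‖w‖ ≤ M)
    (hcl : ∀ p, IsClosed (Φ p)) (hcv : ∀ p, Convex ℝ (Φ p))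
    (hus : ∀ p, ∀ ε > 0, ∃ δ > 0, ∀ q, dist q p < δ → Φ q ⊆ Metric.cthickening ε (Φ p))
    (a : ℝ) (y₀ : En n) :
    ∃ y : ℝ → En n, LipschitzWith M y ∧ y a = y₀ ∧
      ∀ t ≥ a, DifferentiableAt ℝ y t → deriv y t ∈ Φ (y t, t) := by
  choose z u hzL hza hui hz hzu using fun k : ℕ =>
    euler_step Φ M hne hM a y₀ (1 / ((k:ℝ) + 1)) (by positivity)
  let 𝒰 : Ultrafilter ℕ := hyperfilter ℕ
  have hU : (𝒰 : Filter ℕ) ≤ atTop := by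
    rw [← Nat.cofinite_eq_atTop]; exact hyperfilter_le_cofinite
  have hlim : ∀ t, ∃ l, Tendsto (fun k => z k t) 𝒰 (𝓝 l) := by
    intro t
    have hc : IsCompact (Metric.closedBall y₀ (M * dist t a)) := isCompact_closedBall _ _
    obtain ⟨l, _, hl⟩ := isCompact_iff_ultrafilter_le_nhds.1 hc (𝒰.map (fun k => z k t)) (by
      rw [le_principal_iff]
      change ∀ᶠ k in (𝒰 : Filter ℕ), z k t ∈ Metric.closedBall y₀ (M * dist t a)
      refine Filter.Eventually.of_forall fun k => ?_
      have := (hzL k).dist_le_mul t a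
      rw [hza] at this
      exact this)
    exact ⟨l, hl⟩
  choose y hy using hlim
  have hyL : LipschitzWith M y := by
    refine LipschitzWith.of_dist_le_mul fun s t => ?_
    exact le_of_tendsto ((hy s).dist (hy t)) (Eventually.of_forall fun k => (hzL k).dist_le_mul s t)
  refine ⟨y, hyL, ?_, ?_⟩
  · refine tendsto_nhds_unique (hy a) ?_
    simp only [hza]; exact tendsto_const_nhds
  intro t ht hd
  rw [← (hcl (y t, t)).closure_eq, Metric.closure_eq_iInter_cthickening]
  simp only [mem_iInter]
  intro ε hε
  obtain ⟨δ, hδ, hδC⟩ := hus (y t, t) ε hε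
  set C := Metric.cthickening ε (Φ (y t, t)) with hC
  have hCc : IsClosed C := Metric.isClosed_cthickening
  have hCv : Convex ℝ C := (hcv _).cthickening ε
  obtain ⟨η, hη, hη1, hη2⟩ : ∃ η > 0, η < δ ∧ M * η + η < δ := by
    have hp : (0:ℝ) < M + 2 := by positivity
    refine ⟨δ / (M + 2), by positivity, ?_, ?_⟩
    · rw [div_lt_iff₀ hp]; nlinarith [M.coe_nonneg]
    · have : (M:ℝ) * (δ / (M+2)) + δ / (M+2) = δ * (M+1) / (M+2) := by field_simp
      rw [this, div_lt_iff₀ hp]; nlinarith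
  have key : ∀ r, 0 < r → r < η → r⁻¹ • (y (t + r) - y t) ∈ C := by
    intro r hr hrη
    have e1 : ∀ᶠ k in (𝒰 : Filter ℕ), dist (z k t) (y t) < η :=
      (hy t).eventually (Metric.ball_mem_nhds _ hη)
    have e2 : ∀ᶠ k : ℕ in (𝒰 : Filter ℕ), 1 / ((k:ℝ) + 1) < η :=
      hU (tendsto_one_div_add_atTop_nhds_zero_nat.eventually (gt_mem_nhds hη))
    refine hCc.mem_of_tendsto (((hy (t+r)).sub (hy t)).const_smul r⁻¹) ?_
    filter_upwards [e1, e2] with k h1 h2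
    rw [hz]
    have hav : (⨍ s in Ioc t (t+r), u k s) ∈ C := by
      refine hCv.set_average_mem hCc ?_ ?_ ?_ ?_
      · simp [hr]
      · simp
      · refine (ae_restrict_iff' measurableSet_Ioc).2 (Eventually.of_forall fun s hs => ?_)
        obtain ⟨τ, hτ1, hτ2, hτ⟩ := hzu k s (by linarith [hs.1])
        refine hδC _ ?_ hτ
        have ha : |τ - t| < η := by
          rw [abs_lt]; constructor <;> linarith [hs.1, hs.2]
        rw [Prod.dist_eq, max_lt_iff]
        constructor
        · have h3 := (hzL k).dist_le_mul τ t
          rw [Real.dist_eq] at h3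
          have h4 := dist_triangle (z k τ) (z k t) (y t)
          have h5 := mul_le_mul_of_nonneg_left ha.le M.coe_nonneg
          simp only
          linarith
        · rw [Real.dist_eq]; exact ha.trans hη1
      · exact (intervalIntegrable_iff_integrableOn_Ioc_of_le (by linarith)).1 (hui k t (t+r))
    rw [intervalIntegral.integral_of_le (by linarith)]
    rw [setAverage_eq] at hav
    simpa [Measure.real, hr.le] using hav
  have hsl := hd.hasDerivAt.tendsto_slope_zero_right
  refine hCc.mem_of_tendsto hsl ?_
  have : Ioo 0 η ∈ 𝓝[>] (0:ℝ) := Ioo_mem_nhdsGT hη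
  filter_upwards [this] with r hr using key r hr.1 hr.2

lemma lipschitz_ftc {n : ℕ} (M : ℝ≥0) (y : ℝ → En n) (hy : LipschitzWith M y) :
    LocallyIntegrable (deriv y) volume ∧ ∀ a b, ∫ s in a..b, deriv y s = y b - y a := by
  have hb : ∀ s, ‖deriv y s‖ ≤ M := fun s => norm_deriv_le_of_lipschitz hy
  have hli : LocallyIntegrable (deriv y) volume := by
    refine (locallyIntegrable_const (M:ℝ)).mono (measurable_deriv y).aestronglyMeasurable ?_
    exact Eventually.of_forall fun r => by simpa using hb r
  refine ⟨hli, fun a b => ?_⟩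
  ext i
  have hii : IntervalIntegrable (deriv y) volume a b :=
    hli.integrableOn_isCompact isCompact_uIcc |>.intervalIntegrable
  let L : En n →L[ℝ] ℝ := EuclideanSpace.proj i
  have h1 := L.intervalIntegral_comp_comm hii
  have h2 : LipschitzWith (‖L‖₊ * M) (fun s => L (y s)) := L.lipschitz.comp hy
  have h3 := (h2.lipschitzOnWith (s := uIcc a b)).absolutelyContinuousOnInterval.integral_deriv_eq_sub
  have h4 : ∫ s in a..b, deriv (fun s => L (y s)) s = ∫ s in a..b, L (deriv y s) := by
    apply intervalIntegral.integral_congr_ae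
    filter_upwards [hy.ae_differentiableAt_real] with s hs _
    exact (L.hasFDerivAt.comp_hasDerivAt s hs.hasDerivAt).deriv
  have : L (∫ s in a..b, deriv y s) = L (y b) - L (y a) := by rw [← h1, ← h4, h3]
  simpa [L] using this

lemma bounded_on {n : ℕ} (G : Set (En n × ℝ)) (hG : IsCompact G)
    (F : En n → ℝ → Set (En n)) (hUSC : USCOn F G)
    (hne : ∀ p ∈ G, (F p.1 p.2).Nonempty)
    (hcpt : ∀ p ∈ G, IsCompact (F p.1 p.2)) :
    ∃ M : ℝ≥0, ∀ p ∈ G, ∀ w ∈ F p.1 p.2, ‖w‖ ≤ M := by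
  refine hG.induction_on (p := fun S => ∃ M : ℝ≥0, ∀ p ∈ S, ∀ w ∈ F p.1 p.2, ‖w‖ ≤ M)
    ⟨0, by simp⟩ ?_ ?_ ?_
  · rintro s t hst ⟨M, hM⟩
    exact ⟨M, fun p hp => hM p (hst hp)⟩
  · rintro s t ⟨M, hM⟩ ⟨N, hN⟩
    refine ⟨max M N, fun p hp w hw => ?_⟩
    rw [NNReal.coe_max]
    rcases hp with hp | hp
    · exact le_max_of_le_left (hM p hp w hw)
    · exact le_max_of_le_right (hN p hp w hw)
  · intro p hp
    obtain ⟨δ, hδ, h⟩ := hUSC p hp 1 one_pos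
    obtain ⟨R, hR⟩ := (hcpt p hp).isBounded.exists_norm_le
    refine ⟨Metric.ball p δ, mem_nhdsWithin_of_mem_nhds (Metric.ball_mem_nhds _ hδ),
      (R + 1).toNNReal, fun q hq w hw => ?_⟩
    obtain ⟨v, hv, hwv⟩ := (Metric.infDist_lt_iff (hne p hp)).1 (h q hq w hw)
    refine le_trans ?_ (Real.le_coe_toNNReal _)
    have := hR v hv
    rw [dist_eq_norm] at hwv
    have h3 := norm_add_le (w - v) v
    rw [sub_add_cancel] at h3
    linarith

/-- **Continuation of solutions up to the boundary** (Filippov). If `G ⊆ ℝⁿ × ℝ` is compact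
and `F` is upper semicontinuous on `G` with nonempty compact convex values, then every
solution of `ẋ ∈ F (x, t)` on `[t₀, t₁]` whose graph lies in `G` can be extended to a
solution on some `[t₀, T]`, `T ≥ t₁`, with graph in `G`, reaching the boundary of `G`
at time `T`. -/
theorem stmt1 {n : ℕ} (G : Set (En n × ℝ)) (hG : IsCompact G)
    (F : En n → ℝ → Set (En n)) (hUSC : USCOn F G)
    (hne : ∀ p ∈ G, (F p.1 p.2).Nonempty)
    (hcpt : ∀ p ∈ G, IsCompact (F p.1 p.2))
    (hconv : ∀ p ∈ G, Convex ℝ (F p.1 p.2))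
    (t₀ t₁ : ℝ) (ht : t₀ ≤ t₁) (x : ℝ → En n)
    (hsol : IsDISolution F (Set.Icc t₀ t₁) t₀ x)
    (hgraph : ∀ t ∈ Set.Icc t₀ t₁, (x t, t) ∈ G) :
    ∃ T ≥ t₁, ∃ y : ℝ → En n,
      (∀ t ∈ Set.Icc t₀ t₁, y t = x t) ∧
      IsDISolution F (Set.Icc t₀ T) t₀ y ∧
      (∀ t ∈ Set.Icc t₀ T, (y t, t) ∈ G) ∧
      (y T, T) ∈ frontier G := by

  classical
  obtain ⟨M, hM⟩ := bounded_on G hG F hUSC hne hcpt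
  have hint : ∀ p ∈ interior G, p ∈ G := fun p hp => interior_subset hp
  let Φ : En n × ℝ → Set (En n) := fun p =>
    if p ∈ interior G then F p.1 p.2 else Metric.closedBall 0 M
  have hΦ1 : ∀ p ∈ interior G, Φ p = F p.1 p.2 := fun p hp => if_pos hp
  have hΦ2 : ∀ p ∉ interior G, Φ p = Metric.closedBall 0 M := fun p hp => if_neg hp
  have hΦM : ∀ p, ∀ w ∈ Φ p, ‖w‖ ≤ M := by
    intro p w hw
    by_cases hp : p ∈ interior G
    · rw [hΦ1 p hp] at hw; exact hM p (hint p hp) w hw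
    · rw [hΦ2 p hp] at hw; simpa using hw
  obtain ⟨y, hyL, hya, hyd⟩ := exists_global Φ M (by
      intro p
      by_cases hp : p ∈ interior G
      · rw [hΦ1 p hp]; exact hne p (hint p hp)
      · rw [hΦ2 p hp]; exact ⟨0, by simp⟩) hΦM (by
      intro p
      by_cases hp : p ∈ interior G
      · rw [hΦ1 p hp]; exact (hcpt p (hint p hp)).isClosed
      · rw [hΦ2 p hp]; exact Metric.isClosed_closedBall) (by
      intro p
      by_cases hp : p ∈ interior G
      · rw [hΦ1 p hp]; exact hconv p (hint p hp)
      · rw [hΦ2 p hp]; exact convex_closedBall _ _) (by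
      intro p ε hε
      by_cases hp : p ∈ interior G
      · obtain ⟨δ, hδ, h⟩ := hUSC p (hint p hp) ε hε
        obtain ⟨δ', hδ', h'⟩ := Metric.isOpen_iff.1 isOpen_interior p hp
        refine ⟨min δ δ', lt_min hδ hδ', fun q hq w hw => ?_⟩
        rw [hΦ1 q (h' (hq.trans_le (min_le_right _ _)))] at hw
        have := h q (hq.trans_le (min_le_left _ _)) w hw
        rw [hΦ1 p hp]
        obtain ⟨v, hv, hwv⟩ := (Metric.infDist_lt_iff (hne p (hint p hp))).1 this
        exact Metric.mem_cthickening_of_dist_le w v ε _ hv hwv.le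
      · refine ⟨1, one_pos, fun q _ w hw => ?_⟩
        rw [hΦ2 p hp]
        apply Metric.self_subset_cthickening
        simpa using hΦM q w hw) t₁ (x t₁)
  obtain ⟨hyi, hyftc⟩ := lipschitz_ftc M y hyL
  have hcont : Continuous fun t => (y t, t) := hyL.continuous.prodMk continuous_id
  let S : Set ℝ := {t | t₁ ≤ t ∧ (y t, t) ∉ interior G}
  have hSc : IsClosed S :=
    isClosed_Ici.inter ((isOpen_interior.preimage hcont).isClosed_compl)
  have hSb : BddBelow S := ⟨t₁, fun t h => h.1⟩
  have hSn : S.Nonempty := by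
    obtain ⟨R, hR⟩ := hG.isBounded.exists_norm_le
    refine ⟨max t₁ (R + 1), le_max_left _ _, fun hm => ?_⟩
    have h1 := hR _ (hint _ hm)
    have h2 := (norm_snd_le _).trans h1
    have h3 := (le_abs_self _).trans h2
    have h4 := le_max_right t₁ (R + 1)
    simp only at h3
    linarith
  let T := sInf S
  have hTS : T ∈ S := hSc.csInf_mem hSn hSb
  have hTlt : ∀ t, t₁ ≤ t → t < T → (y t, t) ∈ interior G := by
    intro t h1 h2
    by_contra h3
    exact absurd (csInf_le hSb ⟨h1, h3⟩) (not_le.2 h2)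
  have hT1 : t₁ ≤ T := hTS.1
  have hyG : ∀ t, t₁ ≤ t → t ≤ T → (y t, t) ∈ G := by
    intro t h1 h2
    rcases h2.lt_or_eq with h2 | h2
    · exact hint _ (hTlt t h1 h2)
    · rcases h1.lt_or_eq with h1 | h1
      · refine hG.isClosed.mem_of_tendsto (b := 𝓝[<] t) (hcont.continuousAt.tendsto.mono_left
          nhdsWithin_le_nhds) ?_
        filter_upwards [Ioo_mem_nhdsLT h1] with s hs
        exact hint _ (hTlt s hs.1.le (hs.2.trans_eq h2))
      · rw [← h1, hya]; exact hgraph _ ⟨ht, le_rfl⟩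
  obtain ⟨v, hvi, hvx, hvF⟩ := hsol
  let Y : ℝ → En n := fun t => if t ≤ t₁ then x t else y t
  let V : ℝ → En n := fun t => if t ≤ t₁ then v t else deriv y t
  have hY1 : ∀ t, t ≤ t₁ → Y t = x t := fun t h => if_pos h
  have hY2 : ∀ t, t₁ ≤ t → Y t = y t := by
    intro t h
    rcases h.lt_or_eq with h | h
    · exact if_neg (not_le.2 h)
    · rw [← h, hya]; exact hY1 _ le_rfl
  have hVi : LocallyIntegrable V volume := by
    have : V = (Iic t₁).indicator v + (Iic t₁)ᶜ.indicator (deriv y) := by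
      funext t
      by_cases h : t ≤ t₁ <;> simp [V, indicator, h]
    rw [this]
    exact (hvi.indicator measurableSet_Iic).add (hyi.indicator measurableSet_Iic.compl)
  have hVI : ∀ a b, IntervalIntegrable V volume a b := fun a b =>
    (hVi.integrableOn_isCompact isCompact_uIcc).intervalIntegrable
  have hV1 : ∀ t, t₀ ≤ t → t ≤ t₁ → ∫ s in t₀..t, V s = ∫ s in t₀..t, v s := by
    intro t h0 h1
    apply intervalIntegral.integral_congr
    intro s hs
    rw [uIcc_of_le h0] at hs
    exact if_pos (hs.2.trans h1)
  have hV2 : ∀ t, t₁ ≤ t → ∫ s in t₁..t, V s = ∫ s in t₁..t, deriv y s := by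
    intro t h1
    apply intervalIntegral.integral_congr_ae
    refine Eventually.of_forall fun s hs => ?_
    rw [uIoc_of_le h1] at hs
    exact if_neg (not_le.2 hs.1)
  refine ⟨T, hT1, Y, fun t h => hY1 t h.2, ⟨V, hVi, ?_, ?_⟩, ?_, ?_⟩
  · intro t h
    rcases le_total t t₁ with h1 | h1
    · rw [hY1 t h1, hY1 t₀ ht, hV1 t h.1 h1]; exact hvx t ⟨h.1, h1⟩
    · rw [hY2 t h1, hY1 t₀ ht, ← intervalIntegral.integral_add_adjacent_intervals
        (hVI t₀ t₁) (hVI t₁ t), hV1 t₁ ht le_rfl, hV2 t h1, hyftc, ← add_assoc,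
        ← hvx t₁ ⟨ht, le_rfl⟩, hya]
      abel
  · rw [ae_restrict_iff' measurableSet_Icc] at hvF ⊢
    have hT' : ∀ᵐ r : ℝ, r ≠ T := by simp [ae_iff]
    filter_upwards [hvF, hT', hyL.ae_differentiableAt_real] with t h1 h2 h3 h4
    by_cases h5 : t ≤ t₁
    · rw [hY1 t h5]
      simp only [V, if_pos h5]
      exact h1 ⟨h4.1, h5⟩
    · rw [not_le] at h5
      rw [hY2 t h5.le]
      simp only [V, if_neg (not_le.2 h5)]
      have h6 := hyd t h5.le h3
      rwa [hΦ1 _ (hTlt t h5.le (lt_of_le_of_ne h4.2 h2))] at h6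
  · intro t h
    rcases le_total t t₁ with h1 | h1
    · rw [hY1 t h1]; exact hgraph t ⟨h.1, h1⟩
    · rw [hY2 t h1]; exact hyG t h1 h.2
  · rw [hY2 T hT1, frontier, hG.isClosed.closure_eq]
    exact ⟨hyG T hT1 le_rfl, hTS.2⟩
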